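/- arXiv:2412.03470 — 3 statements merged into one kernel-verified Lean document; each statement's English description precedes it below -/
import Mathlib

section
/- Let s ∈ {1/2, 1, 3/2, …}, d = 2s+1 ≥ 2, and let ρ = |ψ⟩⟨ψ| be the pure two-qudit state with Schmidt-form vector |ψ⟩ = Σ_{m=1}^{d} √(μ_m)·|m⟩⊗|m⟩, where μ_m ≥ 0 and Σ_m μ_m = 1. Then the spin-s correlation matrix Z_s(ρ) is diagonal with Z_s^{(11)}(ρ) = −Z_s^{(22)}(ρ) = Σ_{k=1}^{2s} k·(s − (k−1)/2)·√(μ_k μ_{k+1}) and Z_s^{(33)}(ρ) = Σ_{k=1}^{2s+1} (s − (k−1))²·μ_k, and all off-diagonal entries of Z_s(ρ) are zero. -/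
open Matrix Kronecker
open scoped ComplexOrder

/-- Spin-`s` operator `S₁` on `ℂ^d`, `d = 2s+1` (the computational basis is indexed
by `Fin d`, with `i : Fin d` corresponding to the basis vector `|i+1⟩` of the paper). -/
noncomputable def S1 (d : ℕ) : Matrix (Fin d) (Fin d) ℂ :=
  Matrix.of fun i j =>
    if i.1 + 1 = j.1 then (Real.sqrt ((i.1 + 1) * (d - 1 - i.1)) : ℂ) / 2
    else if j.1 + 1 = i.1 then (Real.sqrt ((j.1 + 1) * (d - 1 - j.1)) : ℂ) / 2
    else 0

/-- Spin-`s` operator `S₂` on `ℂ^d`. -/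
noncomputable def S2 (d : ℕ) : Matrix (Fin d) (Fin d) ℂ :=
  Matrix.of fun i j =>
    if i.1 + 1 = j.1 then -(Complex.I * (Real.sqrt ((i.1 + 1) * (d - 1 - i.1)) : ℂ)) / 2
    else if j.1 + 1 = i.1 then Complex.I * (Real.sqrt ((j.1 + 1) * (d - 1 - j.1)) : ℂ) / 2
    else 0

/-- Spin-`s` operator `S₃` on `ℂ^d`. -/
noncomputable def S3 (d : ℕ) : Matrix (Fin d) (Fin d) ℂ :=
  Matrix.of fun i j => if i = j then ((d : ℂ) - 1 - 2 * (i.1 : ℂ)) / 2 else 0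

/-- The triple `(S₁, S₂, S₃)` of spin operators. -/
noncomputable def spinVec (d : ℕ) : Fin 3 → Matrix (Fin d) (Fin d) ℂ := ![S1 d, S2 d, S3 d]

/-- The spin-`s` correlation matrix `Z_s(ρ)`, with entries `tr[ρ (S_i ⊗ S_j)]`
(which are real numbers). -/
noncomputable def Zmat (d : ℕ) (ρ : Matrix (Fin d × Fin d) (Fin d × Fin d) ℂ) :
    Matrix (Fin 3) (Fin 3) ℝ :=
  Matrix.of fun i j => ((ρ * (spinVec d i ⊗ₖ spinVec d j)).trace).re

/-- The inclusion `Fin (d-1) → Fin d`. -/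
def finLo {d : ℕ} (k : Fin (d - 1)) : Fin d := ⟨k.1, by have := k.isLt; omega⟩

/-- The shifted inclusion `Fin (d-1) → Fin d`, `k ↦ k + 1`. -/
def finHi {d : ℕ} (k : Fin (d - 1)) : Fin d := ⟨k.1 + 1, by have := k.isLt; omega⟩

/-- The pure state `ρ = |ψ⟩⟨ψ|` with `|ψ⟩ = Σ_m √(μ_m)·|m⟩⊗|m⟩`. -/
noncomputable def schmidtState (d : ℕ) (μ : Fin d → ℝ) :
    Matrix (Fin d × Fin d) (Fin d × Fin d) ℂ :=
  Matrix.vecMulVec (fun p => if p.1 = p.2 then (Real.sqrt (μ p.1) : ℂ) else 0)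
    (star fun p : Fin d × Fin d => if p.1 = p.2 then (Real.sqrt (μ p.1) : ℂ) else 0)

/-- The expectation of `A ⊗ B` in a Schmidt-form state, as a double sum over the basis. -/
theorem trace_schmidtState_mul_kronecker (d : ℕ) (μ : Fin d → ℝ) (A B : Matrix (Fin d) (Fin d) ℂ) :
    (schmidtState d μ * (A ⊗ₖ B)).trace
      = ∑ a, ∑ b, ((Real.sqrt (μ a) * Real.sqrt (μ b) : ℝ) : ℂ) * (A a b * B a b) := by
  rw [schmidtState, Matrix.vecMulVec_mul, Matrix.trace_vecMulVec, dotProduct_comm]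
  simp only [dotProduct, Matrix.vecMul, Fintype.sum_prod_type, Matrix.kroneckerMap_apply,
    Pi.star_apply, apply_ite star, star_zero, ite_mul, mul_ite, zero_mul, mul_zero,
    Finset.sum_ite_eq, Finset.mem_univ, if_true, RCLike.star_def, Complex.conj_ofReal,
    Finset.sum_mul]
  rw [Finset.sum_comm]
  refine Finset.sum_congr rfl fun a _ => Finset.sum_congr rfl fun b _ => ?_
  push_cast
  ring

/-- A double sum supported on the superdiagonal. -/
theorem sum_sum_superdiagonal {M : Type*} [AddCommMonoid M] (d : ℕ) (g : Fin d → Fin d → M) :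
    ∑ a, ∑ b, (if a.1 + 1 = b.1 then g a b else 0)
      = ∑ k : Fin (d - 1), g (finLo k) (finHi k) := by
  cases d with
  | zero => simp
  | succ n =>
    have key (a : Fin n) : ∑ b : Fin (n + 1),
        (if a.castSucc.1 + 1 = b.1 then g a.castSucc b else 0) = g a.castSucc a.succ := by
      rw [Finset.sum_eq_single a.succ]
      · simp
      · intro b _ hb
        exact if_neg fun h => hb (Fin.ext (by simpa using h.symm))
      · simp
    have last : ∑ b : Fin (n + 1),
        (if (Fin.last n).1 + 1 = b.1 then g (Fin.last n) b else 0) = 0 :=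
      Finset.sum_eq_zero fun b _ => if_neg (by have := b.isLt; simp only [Fin.val_last]; omega)
    rw [Fin.sum_univ_castSucc, last, add_zero]
    exact Finset.sum_congr rfl fun a _ => key a

/-- A symmetric double sum supported on the two off-diagonals. -/
theorem sum_sum_offDiagonal (d : ℕ) (g : Fin d → Fin d → ℝ) :
    ∑ a, ∑ b, (if a.1 + 1 = b.1 then g a b else if b.1 + 1 = a.1 then g b a else 0)
      = 2 * ∑ k : Fin (d - 1), g (finLo k) (finHi k) := by
  have split (a b : Fin d) :
      (if a.1 + 1 = b.1 then g a b else if b.1 + 1 = a.1 then g b a else 0)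
        = (if a.1 + 1 = b.1 then g a b else 0) + (if b.1 + 1 = a.1 then g b a else 0) := by
    split_ifs <;> first | omega | simp
  simp only [split, Finset.sum_add_distrib]
  rw [Finset.sum_comm (f := fun a b : Fin d => if b.1 + 1 = a.1 then g b a else 0),
    sum_sum_superdiagonal, two_mul]

/-- The entries of the spin correlation matrix of a Schmidt-form state. -/
theorem Zmat_schmidtState_apply (d : ℕ) (μ : Fin d → ℝ) (i j : Fin 3) :
    Zmat d (schmidtState d μ) i j
      = ∑ a, ∑ b, Real.sqrt (μ a) * Real.sqrt (μ b) * (spinVec d i a b * spinVec d j a b).re := by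
  rw [Zmat, Matrix.of_apply, trace_schmidtState_mul_kronecker]
  simp only [Complex.re_sum, Complex.re_ofReal_mul]

theorem sqrt_ladder_mul_self {d : ℕ} (i : Fin d) :
    Real.sqrt (((i.1 : ℝ) + 1) * (d - 1 - i.1)) * Real.sqrt (((i.1 : ℝ) + 1) * (d - 1 - i.1))
      = ((i.1 : ℝ) + 1) * (d - 1 - i.1) := by
  have h : (i.1 : ℝ) + 1 ≤ d := by exact_mod_cast i.isLt
  exact Real.mul_self_sqrt (mul_nonneg (by positivity) (by linarith))

theorem re_S1_mul_S1 (d : ℕ) (a b : Fin d) :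
    (S1 d a b * S1 d a b).re
      = if a.1 + 1 = b.1 then ((a.1 : ℝ) + 1) * (d - 1 - a.1) / 4
        else if b.1 + 1 = a.1 then ((b.1 : ℝ) + 1) * (d - 1 - b.1) / 4 else 0 := by
  simp only [S1, Matrix.of_apply]
  split_ifs
  · rw [← sqrt_ladder_mul_self a, div_mul_div_comm]
    norm_num [Complex.div_re]
  · rw [← sqrt_ladder_mul_self b, div_mul_div_comm]
    norm_num [Complex.div_re]
  · simp

theorem S2_mul_S2 (d : ℕ) (a b : Fin d) : S2 d a b * S2 d a b = -(S1 d a b * S1 d a b) := by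
  simp only [S1, S2, Matrix.of_apply]
  split_ifs
  · linear_combination (Real.sqrt (((a.1 : ℝ) + 1) * (d - 1 - a.1)) : ℂ) ^ 2 / 4 * Complex.I_sq
  · linear_combination (Real.sqrt (((b.1 : ℝ) + 1) * (d - 1 - b.1)) : ℂ) ^ 2 / 4 * Complex.I_sq
  · simp

theorem re_S1_mul_S2 (d : ℕ) (a b : Fin d) : (S1 d a b * S2 d a b).re = 0 := by
  simp only [S1, S2, Matrix.of_apply]
  split_ifs <;> simp

theorem S1_mul_S3 (d : ℕ) (a b : Fin d) : S1 d a b * S3 d a b = 0 := by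
  rcases eq_or_ne a b with rfl | h
  · simp [S1]
  · simp [S3, h]

theorem S2_mul_S3 (d : ℕ) (a b : Fin d) : S2 d a b * S3 d a b = 0 := by
  rcases eq_or_ne a b with rfl | h
  · simp [S2]
  · simp [S3, h]

theorem re_S3_mul_S3 (d : ℕ) (a b : Fin d) :
    (S3 d a b * S3 d a b).re = if a = b then (((d : ℝ) - 1 - 2 * a.1) / 2) ^ 2 else 0 := by
  simp only [S3, Matrix.of_apply]
  split_ifs
  · have h : ((d : ℂ) - 1 - 2 * (a.1 : ℂ)) / 2 = ((((d : ℝ) - 1 - 2 * a.1) / 2 : ℝ) : ℂ) := by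
      push_cast
      ring
    rw [h, ← Complex.ofReal_mul, Complex.ofReal_re, sq]
  · simp

theorem Zmat_schmidtState (d : ℕ) (hd : 2 ≤ d) (s : ℝ) (hs : (d : ℝ) = 2 * s + 1)
    (μ : Fin d → ℝ) (hmu0 : ∀ m, 0 ≤ μ m) (hmu1 : ∑ m, μ m = 1) :
    Zmat d (schmidtState d μ) 0 0
        = ∑ k : Fin (d - 1),
            ((k.1 : ℝ) + 1) * (s - (k.1 : ℝ) / 2) * Real.sqrt (μ (finLo k) * μ (finHi k)) ∧
    Zmat d (schmidtState d μ) 1 1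
        = -∑ k : Fin (d - 1),
            ((k.1 : ℝ) + 1) * (s - (k.1 : ℝ) / 2) * Real.sqrt (μ (finLo k) * μ (finHi k)) ∧
    Zmat d (schmidtState d μ) 2 2 = ∑ k : Fin d, (s - (k.1 : ℝ)) ^ 2 * μ k ∧
    (∀ i j : Fin 3, i ≠ j → Zmat d (schmidtState d μ) i j = 0) := by
  have h11 : Zmat d (schmidtState d μ) 0 0 = ∑ k : Fin (d - 1),
      ((k.1 : ℝ) + 1) * (s - (k.1 : ℝ) / 2) * Real.sqrt (μ (finLo k) * μ (finHi k)) := by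
    rw [Zmat_schmidtState_apply]
    have h := sum_sum_offDiagonal d fun a b =>
      Real.sqrt (μ a) * Real.sqrt (μ b) * (((a.1 : ℝ) + 1) * (d - 1 - a.1) / 4)
    calc _ = _ := ?_
      _ = _ := h
      _ = _ := ?_
    · refine Finset.sum_congr rfl fun a _ => Finset.sum_congr rfl fun b _ => ?_
      change _ * (S1 d a b * S1 d a b).re = _
      rw [re_S1_mul_S1, mul_ite, mul_ite, mul_zero, mul_comm (Real.sqrt (μ b))]
    · rw [Finset.mul_sum]
      refine Finset.sum_congr rfl fun k _ => ?_
      rw [Real.sqrt_mul (hmu0 _), hs]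
      simp only [finLo]
      ring
  have off (i j : Fin 3) (h : ∀ a b, (spinVec d i a b * spinVec d j a b).re = 0) :
      Zmat d (schmidtState d μ) i j = 0 := by
    simp [Zmat_schmidtState_apply, h]
  refine ⟨h11, ?_, ?_, ?_⟩
  · rw [← h11, Zmat_schmidtState_apply, Zmat_schmidtState_apply]
    simp only [← Finset.sum_neg_distrib]
    refine Finset.sum_congr rfl fun a _ => Finset.sum_congr rfl fun b _ => ?_
    change _ * (S2 d a b * S2 d a b).re = -(_ * (S1 d a b * S1 d a b).re)
    rw [S2_mul_S2, Complex.neg_re, mul_neg]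
  · rw [Zmat_schmidtState_apply]
    refine Finset.sum_congr rfl fun a _ => ?_
    change ∑ b, _ * (S3 d a b * S3 d a b).re = _
    simp only [re_S3_mul_S3, mul_ite, mul_zero, Finset.sum_ite_eq, Finset.mem_univ, if_true]
    rw [Real.mul_self_sqrt (hmu0 a), hs]
    ring
  · have h12 := off 0 1 (re_S1_mul_S2 d)
    have h13 := off 0 2 fun a b => congrArg Complex.re (S1_mul_S3 d a b)
    have h23 := off 1 2 fun a b => congrArg Complex.re (S2_mul_S3 d a b)
    have symm (i j : Fin 3) : Zmat d (schmidtState d μ) i j = Zmat d (schmidtState d μ) j i := by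
      simp only [Zmat_schmidtState_apply, mul_comm (spinVec d i _ _)]
    intro i j hij
    fin_cases i <;> fin_cases j <;>
      first
        | exact absurd rfl hij
        | assumption
        | exact (symm _ _).trans ‹_›
end

section
/- Let s ∈ {1/2, 1, 3/2, …}, d = 2s+1 ≥ 2, and Φ ∈ [−1, 1]. The spin-s correlation matrix of the two-qudit Werner state ρ_{d,Φ} equals Z_s(ρ_{d,Φ}) = ((dΦ − 1)/12)·I₃, where I₃ is the 3×3 identity matrix. -/
open Matrix Kronecker
open scoped ComplexOrder

/-- The swap (permutation) operator `V_d` on `ℂ^d ⊗ ℂ^d`, `V_d(ψ₁ ⊗ ψ₂) = ψ₂ ⊗ ψ₁`. -/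
noncomputable def swapMat (d : ℕ) : Matrix (Fin d × Fin d) (Fin d × Fin d) ℂ :=
  Matrix.of fun p q => if p.1 = q.2 ∧ p.2 = q.1 then 1 else 0

/-- The two-qudit Werner state
`ρ_{d,Φ} = ((d−Φ)/(d(d²−1)))·I + ((dΦ−1)/(d(d²−1)))·V_d`. -/
noncomputable def wernerState (d : ℕ) (Phi : ℝ) :
    Matrix (Fin d × Fin d) (Fin d × Fin d) ℂ :=
  ((((d : ℝ) - Phi) / ((d : ℝ) * ((d : ℝ) ^ 2 - 1)) : ℝ) : ℂ) • 1 +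
    ((((d : ℝ) * Phi - 1) / ((d : ℝ) * ((d : ℝ) ^ 2 - 1)) : ℝ) : ℂ) • swapMat d

theorem trace_swapMat_mul_kronecker (d : ℕ) (A B : Matrix (Fin d) (Fin d) ℂ) :
    (swapMat d * (A ⊗ₖ B)).trace = (A * B).trace := by
  simp only [Matrix.trace, Matrix.diag_apply, Matrix.mul_apply, swapMat, Matrix.of_apply,
    Matrix.kroneckerMap_apply, Fintype.sum_prod_type, ite_mul, one_mul, zero_mul, ite_and]
  simp only [Finset.sum_ite_eq, Finset.mem_univ, if_true]
  rw [Finset.sum_comm]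

theorem trace_wernerState_mul_kronecker (d : ℕ) (Phi : ℝ) (A B : Matrix (Fin d) (Fin d) ℂ) :
    (wernerState d Phi * (A ⊗ₖ B)).trace =
      ((((d : ℝ) - Phi) / ((d : ℝ) * ((d : ℝ) ^ 2 - 1)) : ℝ) : ℂ) * (A.trace * B.trace) +
      ((((d : ℝ) * Phi - 1) / ((d : ℝ) * ((d : ℝ) ^ 2 - 1)) : ℝ) : ℂ) * (A * B).trace := by
  simp only [wernerState, Matrix.add_mul, Matrix.smul_mul, Matrix.one_mul, Matrix.trace_add,
    Matrix.trace_smul, smul_eq_mul, Matrix.trace_kronecker, trace_swapMat_mul_kronecker]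

/-- The raising operator `S₁ + i S₂`. -/
noncomputable def raising (d : ℕ) : Matrix (Fin d) (Fin d) ℂ :=
  Matrix.of fun i j =>
    if i.1 + 1 = j.1 then (Real.sqrt ((i.1 + 1) * (d - 1 - i.1)) : ℂ) else 0

theorem S1_eq_raising (d : ℕ) : S1 d = (1 / 2 : ℂ) • (raising d + (raising d)ᵀ) := by
  ext i j
  simp only [S1, raising, Matrix.of_apply, Matrix.smul_apply, Matrix.add_apply,
    Matrix.transpose_apply, smul_eq_mul]
  split_ifs
  · omega
  all_goals ring

theorem S2_eq_raising (d : ℕ) :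
    S2 d = (-Complex.I / 2) • (raising d - (raising d)ᵀ) := by
  ext i j
  simp only [S2, raising, Matrix.of_apply, Matrix.smul_apply, Matrix.sub_apply,
    Matrix.transpose_apply, smul_eq_mul]
  split_ifs
  · omega
  all_goals ring

theorem S3_eq_diagonal (d : ℕ) :
    S3 d = Matrix.diagonal fun i : Fin d => ((d : ℂ) - 1 - 2 * (i.1 : ℂ)) / 2 := by
  ext i j
  simp [S3, Matrix.diagonal_apply]

theorem raising_apply_self (d : ℕ) (i : Fin d) : raising d i i = 0 := by
  simp [raising]

theorem trace_raising (d : ℕ) : (raising d).trace = 0 := by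
  simp [Matrix.trace, raising_apply_self]

theorem sum_S3_diag (d : ℕ) (n : ℕ) :
    ∑ i ∈ Finset.range n, ((d : ℂ) - 1 - 2 * (i : ℂ)) / 2 = (n : ℂ) * (d - n) / 2 := by
  induction n with
  | zero => simp
  | succ n ih => rw [Finset.sum_range_succ, ih]; push_cast; ring

theorem trace_S3 (d : ℕ) : (S3 d).trace = 0 := by
  rw [S3_eq_diagonal, Matrix.trace_diagonal,
    Fin.sum_univ_eq_sum_range (fun i : ℕ => ((d : ℂ) - 1 - 2 * (i : ℂ)) / 2), sum_S3_diag]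
  simp

theorem sum_sq_S3_diag (d : ℕ) (n : ℕ) :
    ∑ i ∈ Finset.range n, (((d : ℂ) - 1 - 2 * (i : ℂ)) / 2) ^ 2 =
      (n : ℂ) * (3 * (d - n) ^ 2 + n ^ 2 - 1) / 12 := by
  induction n with
  | zero => simp
  | succ n ih => rw [Finset.sum_range_succ, ih]; push_cast; ring

theorem trace_S3_mul_S3 (d : ℕ) : (S3 d * S3 d).trace = d * (d ^ 2 - 1) / 12 := by
  rw [S3_eq_diagonal, Matrix.diagonal_mul_diagonal, Matrix.trace_diagonal]
  simp only [← pow_two]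
  rw [Fin.sum_univ_eq_sum_range (fun i : ℕ => (((d : ℂ) - 1 - 2 * (i : ℂ)) / 2) ^ 2),
    sum_sq_S3_diag]
  simp

theorem trace_raising_mul_S3 (d : ℕ) : (raising d * S3 d).trace = 0 := by
  simp [S3_eq_diagonal, Matrix.trace, Matrix.mul_diagonal, raising_apply_self]

theorem trace_transpose_raising_mul_S3 (d : ℕ) : ((raising d)ᵀ * S3 d).trace = 0 := by
  simp [S3_eq_diagonal, Matrix.trace, Matrix.mul_diagonal, raising_apply_self]

theorem trace_raising_mul_raising (d : ℕ) : (raising d * raising d).trace = 0 := by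
  simp only [Matrix.trace, Matrix.diag_apply, Matrix.mul_apply]
  refine Finset.sum_eq_zero fun i _ => Finset.sum_eq_zero fun j _ => ?_
  simp only [raising, Matrix.of_apply]
  split_ifs
  · omega
  all_goals simp

theorem raising_mul_transpose_apply_self (d : ℕ) (i : Fin d) :
    (raising d * (raising d)ᵀ) i i = ((i.1 : ℂ) + 1) * (d - 1 - i.1) := by
  simp only [Matrix.mul_apply, Matrix.transpose_apply]
  have hi : (i.1 : ℝ) + 1 ≤ d := by exact_mod_cast i.2
  by_cases h : i.1 + 1 < d
  · rw [Finset.sum_eq_single (⟨i.1 + 1, h⟩ : Fin d)]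
    · simp only [raising, Matrix.of_apply, if_true]
      rw [← Complex.ofReal_mul, Real.mul_self_sqrt]
      · push_cast; ring
      · exact mul_nonneg (by positivity) (by linarith)
    · intro j _ hj
      have : i.1 + 1 ≠ j.1 := fun e => hj (Fin.ext e.symm)
      simp [raising, this]
    · simp
  · have hd : d = i.1 + 1 := by omega
    rw [Finset.sum_eq_zero]
    · have : (d : ℂ) = i.1 + 1 := by exact_mod_cast hd
      rw [this]; ring
    · intro j _
      have : i.1 + 1 ≠ j.1 := by omega
      simp [raising, this]

theorem sum_raising_sq (d : ℕ) (n : ℕ) :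
    ∑ i ∈ Finset.range n, ((i : ℂ) + 1) * (d - 1 - i) =
      (n : ℂ) * (n + 1) * (3 * d - 2 * n - 1) / 6 := by
  induction n with
  | zero => simp
  | succ n ih => rw [Finset.sum_range_succ, ih]; push_cast; ring

theorem trace_raising_mul_transpose (d : ℕ) :
    (raising d * (raising d)ᵀ).trace = d * (d ^ 2 - 1) / 6 := by
  simp only [Matrix.trace, Matrix.diag_apply, raising_mul_transpose_apply_self]
  rw [Fin.sum_univ_eq_sum_range (fun i : ℕ => ((i : ℂ) + 1) * (d - 1 - i)), sum_raising_sq]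
  ring

theorem trace_transpose_mul_raising (d : ℕ) :
    ((raising d)ᵀ * raising d).trace = d * (d ^ 2 - 1) / 6 := by
  rw [Matrix.trace_mul_comm, trace_raising_mul_transpose]

theorem trace_spinVec (d : ℕ) (i : Fin 3) : (spinVec d i).trace = 0 := by
  fin_cases i
  · simp [spinVec, S1_eq_raising, trace_raising]
  · simp [spinVec, S2_eq_raising, trace_raising]
  · simp [spinVec, trace_S3]

theorem trace_spinVec_mul_spinVec (d : ℕ) (i j : Fin 3) :
    (spinVec d i * spinVec d j).trace = if i = j then (d : ℂ) * (d ^ 2 - 1) / 12 else 0 := by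
  have hI := Complex.I_mul_I
  have comm₁ := Matrix.trace_mul_comm (S3 d) (raising d)
  have comm₂ := Matrix.trace_mul_comm (S3 d) (raising d)ᵀ
  rw [trace_raising_mul_S3] at comm₁
  rw [trace_transpose_raising_mul_S3] at comm₂
  fin_cases i <;> fin_cases j <;>
    simp [spinVec, S1_eq_raising, S2_eq_raising, Matrix.add_mul, Matrix.mul_add, Matrix.sub_mul,
      Matrix.mul_sub, trace_raising_mul_S3, trace_transpose_raising_mul_S3,
      trace_raising_mul_raising, trace_raising_mul_transpose, trace_transpose_mul_raising,
      trace_S3_mul_S3, comm₁, comm₂] <;>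
    grind

theorem Zmat_werner (d : ℕ) (hd : 2 ≤ d) (s : ℝ) (hs : (d : ℝ) = 2 * s + 1) (Phi : ℝ) (hPhi : Phi ∈ Set.Icc (-1 : ℝ) 1) :
    Zmat d (wernerState d Phi)
      = (((d : ℝ) * Phi - 1) / 12) • (1 : Matrix (Fin 3) (Fin 3) ℝ) := by
  have hd2 : (2 : ℝ) ≤ d := by exact_mod_cast hd
  have h₁ : (d : ℝ) ≠ 0 := by positivity
  have h₂ : (d : ℝ) ^ 2 - 1 ≠ 0 := by nlinarith
  ext i j
  have key : (spinVec d i * spinVec d j).trace =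
      (((if i = j then (d : ℝ) * (d ^ 2 - 1) / 12 else 0 : ℝ)) : ℂ) := by
    rw [trace_spinVec_mul_spinVec]
    split_ifs <;> push_cast <;> rfl
  rw [Zmat, Matrix.of_apply, trace_wernerState_mul_kronecker, trace_spinVec, zero_mul, mul_zero,
    zero_add, key, ← Complex.ofReal_mul, Complex.ofReal_re, Matrix.smul_apply, Matrix.one_apply,
    smul_eq_mul]
  split_ifs
  · field_simp
  · simp
end

section
/- Let s ∈ {1/2, 1, 3/2, …}, d = 2s+1 ≥ 2, and let ρ be a two-qudit state on ℂ^d ⊗ ℂ^d whose matrix entries ζ_{mm',kk'} = ⟨m k| ρ |m' k'⟩ in the computational product basis are all real. Then the spin-s correlation matrix Z_s(ρ) satisfies Z_s^{(12)}(ρ) = Z_s^{(21)}(ρ) = Z_s^{(23)}(ρ) = Z_s^{(32)}(ρ) = 0, i.e. Z_s(ρ) has the block form with only possibly nonzero entries at positions (1,1), (1,3), (2,2), (3,1), (3,3). -/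
open Matrix Kronecker
open scoped ComplexOrder

lemma S1_im (d : ℕ) (i j : Fin d) : (S1 d i j).im = 0 := by
  simp only [S1, Matrix.of_apply]
  split_ifs <;> simp

lemma S2_re (d : ℕ) (i j : Fin d) : (S2 d i j).re = 0 := by
  simp only [S2, Matrix.of_apply]
  split_ifs <;> simp

lemma S3_im (d : ℕ) (i j : Fin d) : (S3 d i j).im = 0 := by
  simp only [S3, Matrix.of_apply]
  split_ifs <;> simp

/-- The trace of a product of a real matrix with a purely imaginary one is purely imaginary. -/
lemma trace_mul_re_eq_zero {n : Type*} [Fintype n] {A B : Matrix n n ℂ}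
    (hA : ∀ p q, (A p q).im = 0) (hB : ∀ p q, (B p q).re = 0) : (A * B).trace.re = 0 := by
  simp [Matrix.trace, Matrix.mul_apply, Complex.mul_re, hA, hB]

theorem Zmat_real_entries_block_form (d : ℕ) (hd : 2 ≤ d) (s : ℝ) (hs : (d : ℝ) = 2 * s + 1)
    (ρ : Matrix (Fin d × Fin d) (Fin d × Fin d) ℂ)
    (hrho : ρ.PosSemidef) (htr : ρ.trace = 1)
    (hreal : ∀ p q : Fin d × Fin d, (ρ p q).im = 0) :
    Zmat d ρ 0 1 = 0 ∧ Zmat d ρ 1 0 = 0 ∧ Zmat d ρ 1 2 = 0 ∧ Zmat d ρ 2 1 = 0 := by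
  refine ⟨?_, ?_, ?_, ?_⟩ <;>
    refine trace_mul_re_eq_zero hreal fun p q => ?_ <;>
    simp [spinVec, Matrix.kroneckerMap_apply, Complex.mul_re, S1_im, S2_re, S3_im]
end
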